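/- For each n ≥ 1 let ε_n ∈ (0,1), let X_n be an n×n real Gaussian matrix, let f_n = perm(X_n)² and g_n = E[perm(Y_n)² | X_n], where Y_n is an ε_n-noise of X_n. If n·ε_n → ∞ as n → ∞, then corr(f_n, g_n) → 0 as n → ∞. -/

import Mathlib

open MeasureTheory ProbabilityTheory Filter

/-- The distribution of an n×n real Gaussian matrix: i.i.d. standard real Gaussian
entries (mean 0, variance 1). -/
noncomputable def gMatR (n : ℕ) : Measure (Fin n → Fin n → ℝ) :=
  Measure.pi fun _ => Measure.pi fun _ => gaussianReal 0 1

/-- The permanent of an n×n real matrix. -/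
noncomputable def rperm {n : ℕ} (A : Fin n → Fin n → ℝ) : ℝ :=
  ∑ σ : Equiv.Perm (Fin n), ∏ i, A i (σ i)

/-- The ε-noise of a matrix X with noise matrix U: √(1-ε)·X + √ε·U. -/
noncomputable def noisyR {n : ℕ} (ε : ℝ) (X U : Fin n → Fin n → ℝ) : Fin n → Fin n → ℝ :=
  fun i j => Real.sqrt (1 - ε) * X i j + Real.sqrt ε * U i j

/-- g(X) = E[perm(Y)² | X], where Y is an ε-noise of X: since the noise matrix U is
independent of X, this conditional expectation is the integral over U. -/
noncomputable def gFunR (n : ℕ) (ε : ℝ) (X : Fin n → Fin n → ℝ) : ℝ :=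
  ∫ U, (rperm (noisyR ε X U)) ^ 2 ∂(gMatR n)

/-- Covariance of two real random variables: Cov(f,g) = E[(f - E f)(g - E g)]. -/
noncomputable def cov {α : Type*} [MeasurableSpace α] (μ : Measure α) (f g : α → ℝ) : ℝ :=
  ∫ x, (f x - ∫ y, f y ∂μ) * (g x - ∫ y, g y ∂μ) ∂μ

/-- Correlation: corr(f,g) = Cov(f,g)/(√Var(f)·√Var(g)). -/
noncomputable def corr {α : Type*} [MeasurableSpace α] (μ : Measure α) (f g : α → ℝ) : ℝ :=
  cov μ f g / (Real.sqrt (cov μ f f) * Real.sqrt (cov μ g g))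

section GaussianMoments

/-- The fourth moment of a standard real Gaussian variable is `3`. -/
lemma integral_pow_four_gaussianReal : ∫ x, x ^ 4 ∂gaussianReal 0 1 = 3 := by
  have h := iteratedDeriv_mgf_zero (X := id) (μ := gaussianReal 0 1)
    (by simp [integrableExpSet_id_gaussianReal]) 4
  have hderiv (P : Polynomial ℝ) : deriv (fun t => P.eval t * Real.exp (t ^ 2 / 2))
      = fun t => (P.derivative + Polynomial.X * P).eval t * Real.exp (t ^ 2 / 2) := by
    funext t
    have hsq : HasDerivAt (fun t : ℝ => t ^ 2 / 2) t t := by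
      simpa using (hasDerivAt_pow 2 t).div_const 2
    refine ((P.hasDerivAt t).mul hsq.exp).deriv.trans ?_
    simp only [Polynomial.eval_add, Polynomial.eval_mul, Polynomial.eval_X]
    ring
  have hmgf : mgf id (gaussianReal 0 1)
      = fun t => (1 : Polynomial ℝ).eval t * Real.exp (t ^ 2 / 2) := by
    rw [mgf_id_gaussianReal]
    funext t
    simp
  rw [hmgf, iteratedDeriv_succ, iteratedDeriv_succ, iteratedDeriv_succ, iteratedDeriv_one,
    hderiv, hderiv, hderiv, hderiv] at h
  norm_num at h
  exact h.symm

lemma integral_pow_three_gaussianReal : ∫ x, x ^ 3 ∂gaussianReal 0 1 = 0 := by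
  have h : ∫ x, x ^ 3 ∂((gaussianReal 0 1).map fun x => -x) = ∫ x, (-x) ^ 3 ∂gaussianReal 0 1 :=
    integral_map (by fun_prop) (by fun_prop)
  rw [gaussianReal_map_neg, neg_zero] at h
  simp only [Odd.neg_pow (by decide : Odd 3), integral_neg] at h
  linarith

lemma integral_pow_two_gaussianReal : ∫ x, x ^ 2 ∂gaussianReal 0 1 = 1 := by
  have h := variance_fun_id_gaussianReal (μ := 0) (v := 1)
  rw [variance_eq_integral (by fun_prop)] at h
  simpa using h

lemma integral_pow_one_gaussianReal : ∫ x, x ^ 1 ∂gaussianReal 0 1 = 0 := by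
  simp

lemma integrable_pow_gaussianReal (k : ℕ) :
    Integrable (fun x => x ^ k) (gaussianReal 0 1) :=
  integrable_pow_of_mem_interior_integrableExpSet (X := id)
    (by simp [integrableExpSet_id_gaussianReal]) k

lemma integral_eval_gaussian {ι : Type*} [Fintype ι] (a : ι) :
    ∫ x : ι → ℝ, x a ∂(Measure.pi fun _ => gaussianReal 0 1) = 0 := by
  have := integral_comp_eval (μ := fun _ : ι => gaussianReal 0 1) (i := a) (f := fun x : ℝ => x)
    (by fun_prop)
  rw [this]
  simp

variable {ι : Type*} [Fintype ι] [DecidableEq ι]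

lemma prod_pow_count_four (x : ι → ℝ) (a b c d : ι) :
    x a * x b * (x c * x d) = ∏ j, x j ^ ((if j = a then 1 else 0) + (if j = b then 1 else 0)
      + (if j = c then 1 else 0) + (if j = d then 1 else 0)) := by
  simp only [pow_add, Finset.prod_mul_distrib, pow_ite, pow_one, pow_zero,
    Finset.prod_ite_eq', Finset.mem_univ, if_true]
  ring

lemma prod_pow_count_two (x : ι → ℝ) (a b : ι) :
    x a * x b = ∏ j, x j ^ ((if j = a then 1 else 0) + (if j = b then 1 else 0)) := by
  simp only [pow_add, Finset.prod_mul_distrib, pow_ite, pow_one, pow_zero,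
    Finset.prod_ite_eq', Finset.mem_univ, if_true]

lemma integrable_mul_mul_gaussian (a b c d : ι) :
    Integrable (fun x : ι → ℝ => x a * x b * (x c * x d))
      (Measure.pi fun _ => gaussianReal 0 1) := by
  simp only [prod_pow_count_four]
  exact Integrable.fintype_prod fun j => integrable_pow_gaussianReal _

lemma integrable_mul_gaussian (a b : ι) :
    Integrable (fun x : ι → ℝ => x a * x b) (Measure.pi fun _ => gaussianReal 0 1) := by
  simp only [prod_pow_count_two]
  exact Integrable.fintype_prod fun j => integrable_pow_gaussianReal _

lemma integrable_eval_gaussian (a : ι) :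
    Integrable (fun x : ι → ℝ => x a) (Measure.pi fun _ => gaussianReal 0 1) := by
  have h (x : ι → ℝ) : x a = ∏ j, x j ^ (if j = a then 1 else 0) := by
    simp [pow_ite]
  simp only [h]
  exact Integrable.fintype_prod fun j => integrable_pow_gaussianReal _

lemma integral_mul_gaussian (a b : ι) :
    ∫ x : ι → ℝ, x a * x b ∂(Measure.pi fun _ => gaussianReal 0 1) = if a = b then 1 else 0 := by
  simp only [prod_pow_count_two]
  rw [integral_fintype_prod_eq_prod (fun j (y : ℝ) =>
    y ^ ((if j = a then 1 else 0) + (if j = b then 1 else 0)))]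
  split_ifs with h
  · subst h
    refine Finset.prod_eq_one fun j _ => ?_
    split_ifs
    · exact integral_pow_two_gaussianReal
    · simp
  · refine Finset.prod_eq_zero (Finset.mem_univ a) ?_
    simp [h]

/-- Wick's formula for four coordinates of a standard Gaussian vector. -/
lemma integral_mul_mul_gaussian (a b c d : ι) :
    ∫ x : ι → ℝ, x a * x b * (x c * x d) ∂(Measure.pi fun _ => gaussianReal 0 1)
      = (if a = b ∧ c = d then 1 else 0) + (if a = c ∧ b = d then 1 else 0)
        + (if a = d ∧ b = c then 1 else 0) := by
  simp only [prod_pow_count_four]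
  rw [integral_fintype_prod_eq_prod (fun j (y : ℝ) => y ^ ((if j = a then 1 else 0)
    + (if j = b then 1 else 0) + (if j = c then 1 else 0) + (if j = d then 1 else 0)))]
  have two (p q : ι) (h : p ≠ q) :
      (∀ j, (if j = a then 1 else 0) + (if j = b then 1 else 0) + (if j = c then 1 else 0)
        + (if j = d then 1 else 0) = (if j = p then 2 else 0) + (if j = q then 2 else 0)) →
      ∏ j, ∫ y : ℝ, y ^ ((if j = a then 1 else 0) + (if j = b then 1 else 0)
        + (if j = c then 1 else 0) + (if j = d then 1 else 0)) ∂gaussianReal 0 1 = 1 := by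
    intro H
    refine Finset.prod_eq_one fun j _ => ?_
    rw [H]
    by_cases hp : j = p
    · have : j ≠ q := hp ▸ h
      simp [hp, h, integral_pow_two_gaussianReal]
    · by_cases hq : j = q
      · simp [hq, h.symm, integral_pow_two_gaussianReal]
      · simp [hp, hq]
  have zero (p : ι)
      (h : (if p = a then 1 else 0) + (if p = b then 1 else 0) + (if p = c then 1 else 0)
        + (if p = d then 1 else 0) = 1 ∨ (if p = a then 1 else 0) + (if p = b then 1 else 0) +
        (if p = c then 1 else 0) + (if p = d then 1 else 0) = 3) :
      ∏ j, ∫ y : ℝ, y ^ ((if j = a then 1 else 0) + (if j = b then 1 else 0)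
        + (if j = c then 1 else 0) + (if j = d then 1 else 0)) ∂gaussianReal 0 1 = 0 := by
    refine Finset.prod_eq_zero (Finset.mem_univ p) ?_
    rcases h with h | h <;> rw [h]
    · exact integral_pow_one_gaussianReal
    · exact integral_pow_three_gaussianReal
  by_cases hab : a = b
  · by_cases hcd : c = d
    · by_cases hac : a = c
      · subst hab hcd hac
        rw [Finset.prod_eq_single a]
        · simp [integral_pow_four_gaussianReal]
          norm_num
        · intro j _ hj
          simp [hj]
        · simp
      · subst hab hcd
        rw [two a c hac (fun j => by split_ifs <;> rfl)]
        simp [hac]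
    · by_cases hac : a = c
      · subst hab hac
        rw [zero d (by simp [Ne.symm hcd])]
        simp [hcd]
      · subst hab
        rw [zero c (by simp [Ne.symm hac, hcd])]
        simp [hac, hcd]
  · by_cases hac : a = c
    · subst hac
      by_cases hbd : b = d
      · subst hbd
        rw [two a b hab (fun j => by split_ifs <;> rfl)]
        simp [hab, Ne.symm hab]
      · rw [zero b (by simp [Ne.symm hab, hbd])]
        simp [hab, hbd]
        grind
    · by_cases had : a = d
      · subst had
        by_cases hbc : b = c
        · subst hbc
          rw [two a b hab (fun j => by split_ifs <;> rfl)]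
          simp [hab]
        · rw [zero b (by simp [Ne.symm hab, hbc])]
          simp [hab, hbc, Ne.symm hab]
      · rw [zero a (by simp [hab, hac, had])]
        simp [hab, hac, had]

end GaussianMoments

section PermutationCounting

open Equiv Finset

lemma sum_factorial_mul_factorial {α : Type*} [DecidableEq α] (s : Finset α) :
    ∑ t ∈ s.powerset, (#t).factorial * (#(s \ t)).factorial = (#s + 1) * (#s).factorial := by
  have h : ∀ t ∈ s.powerset, (#t).factorial * (#(s \ t)).factorial
      = (fun m => m.factorial * (#s - m).factorial) #t := by
    intro t ht
    rw [card_sdiff_of_subset (mem_powerset.1 ht)]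
  refine (sum_congr rfl h).trans ((sum_powerset_apply_card (fun m =>
    m.factorial * (#s - m).factorial)).trans ?_)
  have h2 : ∀ m ∈ range (#s + 1), (#s).choose m • (m.factorial * (#s - m).factorial)
      = (#s).factorial := by
    intro m hm
    rw [smul_eq_mul, ← mul_assoc]
    exact Nat.choose_mul_factorial_mul_factorial (by simpa [Nat.lt_succ_iff] using hm)
  rw [sum_congr rfl h2]
  simp

variable {α : Type*} [Fintype α] [DecidableEq α]

/-- For a partition of `α` into `A`, `B`, `C`, the triples of permutations that are the identity on
`A`, `B`, `C` respectively, while the other two agree there, come from a permutation of each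
part. -/
lemma card_perm_triples (A B C : Finset α) (hAB : Disjoint A B) (hAC : Disjoint A C)
    (hBC : Disjoint B C) (hABC : ∀ x, x ∈ A ∨ x ∈ B ∨ x ∈ C) :
    #{τ : Perm α × Perm α × Perm α | (∀ i ∈ A, i = τ.1 i ∧ τ.2.1 i = τ.2.2 i) ∧
      (∀ i ∈ B, i = τ.2.1 i ∧ τ.1 i = τ.2.2 i) ∧ (∀ i ∈ C, i = τ.2.2 i ∧ τ.1 i = τ.2.1 i)}
      = (#A).factorial * ((#B).factorial * (#C).factorial) := by
  have hcard : Fintype.card (Perm A × Perm B × Perm C)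
      = (#A).factorial * ((#B).factorial * (#C).factorial) := by
    simp [Fintype.card_perm]
  rw [← hcard, ← card_univ]
  have nAB : ∀ x ∈ A, x ∉ B := fun _ => (disjoint_left.1 hAB ·)
  have nAC : ∀ x ∈ A, x ∉ C := fun _ => (disjoint_left.1 hAC ·)
  have nBC : ∀ x ∈ B, x ∉ C := fun _ => (disjoint_left.1 hBC ·)
  have mem {S : Finset α} (f : Perm S) (x : α) (hx : x ∈ S) : Perm.ofSubtype f x ∈ S :=
    (Perm.ofSubtype_apply_mem_iff_mem (p := (· ∈ S)) f x).2 hx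
  have fix {S : Finset α} (f : Perm S) (x : α) (hx : x ∉ S) : Perm.ofSubtype f x = x :=
    Perm.ofSubtype_apply_of_not_mem f hx
  symm
  refine card_bij (fun π _ => (Perm.ofSubtype π.2.1 * Perm.ofSubtype π.2.2,
    Perm.ofSubtype π.1 * Perm.ofSubtype π.2.2, Perm.ofSubtype π.1 * Perm.ofSubtype π.2.1)) ?_ ?_ ?_
  · rintro ⟨a, b, c⟩ -
    have ha := mem a
    have hb := mem b
    have hc := mem c
    have fa := fix a
    have fb := fix b
    have fc := fix c
    simp only [mem_filter, mem_univ, true_and, Perm.mul_apply]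
    refine ⟨?_, ?_, ?_⟩ <;> grind
  · rintro ⟨a, b, c⟩ - ⟨a', b', c'⟩ - h
    simp only [Prod.mk.injEq] at h
    obtain ⟨h1, h2, h3⟩ := h
    have e1 (x : α) := DFunLike.congr_fun h1 x
    have e2 (x : α) := DFunLike.congr_fun h2 x
    simp only [Perm.mul_apply] at e1 e2
    have key {S : Finset α} (f g : Perm S)
        (h : ∀ x ∈ S, Perm.ofSubtype f x = Perm.ofSubtype g x) : f = g := by
      ext x
      simpa using h x x.2
    refine Prod.ext (key _ _ fun x hx => ?_)
      (Prod.ext (key _ _ fun x hx => ?_) (key _ _ fun x hx => ?_))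
    · have := e2 x
      rwa [fix c x (nAC x hx), fix c' x (nAC x hx)] at this
    · have := e1 x
      rwa [fix c x (nBC x hx), fix c' x (nBC x hx)] at this
    · have := e2 x
      have hA (f : Perm C) : Perm.ofSubtype f x ∉ A := fun h => nAC _ h (mem f x hx)
      rwa [fix a _ (hA c), fix a' _ (hA c')] at this
  · rintro ⟨τ₁, τ₂, τ₃⟩ hτ
    simp only [mem_filter, mem_univ, true_and] at hτ
    obtain ⟨hA, hB, hC⟩ := hτ
    have pA (x : α) : τ₂ x ∈ A ↔ x ∈ A := by
      have := τ₁.injective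
      have := τ₂.injective
      have := τ₃.injective
      constructor <;> intro hx <;> grind [Function.Injective]
    have pB (x : α) : τ₁ x ∈ B ↔ x ∈ B := by
      have := τ₁.injective
      have := τ₂.injective
      have := τ₃.injective
      constructor <;> intro hx <;> grind [Function.Injective]
    have pC (x : α) : τ₁ x ∈ C ↔ x ∈ C := by
      have := τ₁.injective
      have := τ₂.injective
      have := τ₃.injective
      constructor <;> intro hx <;> grind [Function.Injective]
    have vA (x : α) (hx : x ∈ A) : Perm.ofSubtype (τ₂.subtypePerm pA) x = τ₂ x :=
      Perm.ofSubtype_subtypePerm_of_mem pA hx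
    have vB (x : α) (hx : x ∈ B) : Perm.ofSubtype (τ₁.subtypePerm pB) x = τ₁ x :=
      Perm.ofSubtype_subtypePerm_of_mem pB hx
    have vC (x : α) (hx : x ∈ C) : Perm.ofSubtype (τ₁.subtypePerm pC) x = τ₁ x :=
      Perm.ofSubtype_subtypePerm_of_mem pC hx
    have fA := fix (τ₂.subtypePerm pA)
    have fB := fix (τ₁.subtypePerm pB)
    have fC := fix (τ₁.subtypePerm pC)
    refine ⟨(τ₂.subtypePerm pA, τ₁.subtypePerm pB, τ₁.subtypePerm pC), mem_univ _, ?_⟩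
    refine Prod.ext (Perm.ext fun x => ?_) (Prod.ext (Perm.ext fun x => ?_)
      (Perm.ext fun x => ?_)) <;> simp only [Perm.mul_apply] <;>
      rcases hABC x with hx | hx | hx <;> grind

lemma sum_factorial_mul_factorial_mul_pow (r : ℝ) :
    ∑ t : Finset α, ((#t).factorial : ℝ) * (((#tᶜ + 1 : ℕ) : ℝ) * (#tᶜ).factorial) * r ^ #tᶜ
      = (Fintype.card α).factorial * ∑ k ∈ range (Fintype.card α + 1), ((k : ℝ) + 1) * r ^ k := by
  set N := Fintype.card α with hN
  have hN' : #(univ : Finset α) = N := card_univ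
  rw [← Equiv.sum_comp (Function.Involutive.toPerm _ (compl_involutive (α := Finset α)))]
  have h : ∀ t ∈ (univ : Finset α).powerset,
      ((#tᶜ).factorial : ℝ) * (((#tᶜᶜ + 1 : ℕ) : ℝ) * (#tᶜᶜ).factorial) * r ^ #tᶜᶜ
        = (fun m => ((N - m).factorial : ℝ) * (((m + 1 : ℕ) : ℝ) * m.factorial) * r ^ m) #t := by
    intro t _
    rw [compl_compl, card_compl]
  rw [← powerset_univ]
  refine (sum_congr rfl h).trans ((sum_powerset_apply_card (fun m =>
    ((N - m).factorial : ℝ) * (((m + 1 : ℕ) : ℝ) * m.factorial) * r ^ m)).trans ?_)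
  rw [hN', mul_sum]
  refine sum_congr rfl fun m hm => ?_
  have := Nat.choose_mul_factorial_mul_factorial (n := N) (k := m)
    (by simpa [Nat.lt_succ_iff] using hm)
  rw [nsmul_eq_mul, ← this]
  push_cast
  ring

/-- The weight of a quadruple of permutations in the Wick expansion of the second moment of a
squared Gaussian permanent, with `r` marking the two crossed pairings. -/
noncomputable def wickWeight (r : ℝ) (a b c d : α) : ℝ :=
  (if a = b ∧ c = d then 1 else 0)
    + r * ((if a = c ∧ b = d then 1 else 0) + (if a = d ∧ b = c then 1 else 0))

lemma sum_prod_wickWeight_triples (r : ℝ) :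
    ∑ τ : Perm α × Perm α × Perm α, ∏ i, wickWeight r i (τ.1 i) (τ.2.1 i) (τ.2.2 i)
      = (Fintype.card α).factorial * ∑ k ∈ range (Fintype.card α + 1), ((k : ℝ) + 1) * r ^ k := by
  have hexp (τ : Perm α × Perm α × Perm α) :
      ∏ i, wickWeight r i (τ.1 i) (τ.2.1 i) (τ.2.2 i)
        = ∑ A : Finset α, ∑ B ∈ Aᶜ.powerset,
          (if (∀ i ∈ A, i = τ.1 i ∧ τ.2.1 i = τ.2.2 i) ∧ (∀ i ∈ B, i = τ.2.1 i ∧ τ.1 i = τ.2.2 i) ∧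
            (∀ i ∈ Aᶜ \ B, i = τ.2.2 i ∧ τ.1 i = τ.2.1 i) then 1 else 0) * r ^ #Aᶜ := by
    simp only [wickWeight]
    rw [Fintype.prod_add]
    refine sum_congr rfl fun A _ => ?_
    rw [prod_mul_distrib, prod_const, prod_add, prod_ite_zero, mul_sum, mul_sum]
    refine sum_congr rfl fun B _ => ?_
    rw [prod_ite_zero, prod_ite_zero]
    simp only [prod_const_one, ite_and, mul_ite, ite_mul, mul_one, one_mul, mul_zero, zero_mul]
    split_ifs <;> rfl
  rw [sum_congr rfl fun τ _ => hexp τ, sum_comm, ← sum_factorial_mul_factorial_mul_pow]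
  refine sum_congr rfl fun A _ => ?_
  rw [sum_comm, ← Nat.cast_mul (#Aᶜ + 1), ← sum_factorial_mul_factorial, Nat.cast_sum, mul_sum,
    sum_mul]
  refine sum_congr rfl fun B hB => ?_
  have hB := mem_powerset.1 hB
  rw [← Nat.cast_mul, ← card_perm_triples A B (Aᶜ \ B)
    (disjoint_compl_right.mono_right hB) (disjoint_compl_right.mono_right sdiff_subset)
    disjoint_sdiff (fun x => by simp; tauto), card_filter, Nat.cast_sum, sum_mul]
  refine sum_congr rfl fun τ _ => ?_
  rw [Nat.cast_ite, Nat.cast_one, Nat.cast_zero]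

lemma sum_prod_wickWeight (r : ℝ) :
    ∑ σ₁ : Perm α, ∑ σ₂ : Perm α, ∑ σ₃ : Perm α, ∑ σ₄ : Perm α,
        ∏ i, wickWeight r (σ₁ i) (σ₂ i) (σ₃ i) (σ₄ i)
      = (Fintype.card α).factorial ^ 2
        * ∑ k ∈ range (Fintype.card α + 1), ((k : ℝ) + 1) * r ^ k := by
  have h (σ : Perm α) : ∑ σ₂ : Perm α, ∑ σ₃ : Perm α, ∑ σ₄ : Perm α,
        ∏ i, wickWeight r (σ i) (σ₂ i) (σ₃ i) (σ₄ i)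
      = (Fintype.card α).factorial * ∑ k ∈ range (Fintype.card α + 1), ((k : ℝ) + 1) * r ^ k := by
    rw [← sum_prod_wickWeight_triples, Fintype.sum_prod_type, ← Equiv.sum_comp (Equiv.mulLeft σ)]
    refine sum_congr rfl fun τ₁ _ => ?_
    rw [Fintype.sum_prod_type, ← Equiv.sum_comp (Equiv.mulLeft σ)]
    refine sum_congr rfl fun τ₂ _ => ?_
    rw [← Equiv.sum_comp (Equiv.mulLeft σ)]
    refine sum_congr rfl fun τ₃ _ => ?_
    simp [wickWeight]
  rw [sum_congr rfl fun σ _ => h σ, sum_const, card_univ, Fintype.card_perm, nsmul_eq_mul]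
  ring

end PermutationCounting

section Covariance

variable {n : ℕ}

/-- The mean of `(√(1-ε) x a + √ε u a) (√(1-ε) x b + √ε u b)` over a Gaussian row `u`. -/
noncomputable def noisyPair (ε : ℝ) (a b : Fin n) (x : Fin n → ℝ) : ℝ :=
  (1 - ε) * (x a * x b) + if a = b then ε else 0

lemma integrable_noisyPair (ε : ℝ) (a b : Fin n) :
    Integrable (noisyPair ε a b) (Measure.pi fun _ => gaussianReal 0 1) :=
  ((integrable_mul_gaussian a b).const_mul _).add (integrable_const _)

lemma integral_noisyPair (ε : ℝ) (a b : Fin n) :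
    ∫ x, noisyPair ε a b x ∂(Measure.pi fun _ => gaussianReal 0 1) = if a = b then 1 else 0 := by
  simp only [noisyPair]
  rw [integral_add ((integrable_mul_gaussian a b).const_mul _) (integrable_const _),
    integral_const_mul, integral_mul_gaussian]
  split_ifs <;> simp

lemma noisyPair_mul_noisyPair (ε δ : ℝ) (a b c d : Fin n) (x : Fin n → ℝ) :
    noisyPair ε a b x * noisyPair δ c d x
      = (1 - ε) * (1 - δ) * (x a * x b * (x c * x d))
        + ((1 - ε) * (if c = d then δ else 0) * (x a * x b)
        + ((1 - δ) * (if a = b then ε else 0) * (x c * x d)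
        + (if a = b then ε else 0) * (if c = d then δ else 0))) := by
  simp only [noisyPair]
  ring

lemma integrable_noisyPair_mul (ε δ : ℝ) (a b c d : Fin n) :
    Integrable (fun x => noisyPair ε a b x * noisyPair δ c d x)
      (Measure.pi fun _ => gaussianReal 0 1) := by
  simp only [noisyPair_mul_noisyPair]
  exact ((integrable_mul_mul_gaussian a b c d).const_mul _).add
    (((integrable_mul_gaussian a b).const_mul _).add
      (((integrable_mul_gaussian c d).const_mul _).add (integrable_const _)))

lemma integral_noisyPair_mul (ε δ : ℝ) (a b c d : Fin n) :
    ∫ x, noisyPair ε a b x * noisyPair δ c d x ∂(Measure.pi fun _ => gaussianReal 0 1)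
      = wickWeight ((1 - ε) * (1 - δ)) a b c d := by
  simp only [noisyPair_mul_noisyPair]
  have i1 := integrable_mul_mul_gaussian a b c d
  have i2 := integrable_mul_gaussian a b
  have i3 := integrable_mul_gaussian c d
  rw [integral_add (by fun_prop) (by fun_prop), integral_add (by fun_prop) (by fun_prop),
    integral_add (by fun_prop) (by fun_prop),
    integral_const_mul, integral_const_mul, integral_const_mul, integral_mul_mul_gaussian,
    integral_mul_gaussian, integral_mul_gaussian, wickWeight, integral_const]
  by_cases hab : a = b <;> by_cases hcd : c = d <;> (simp [hab, hcd]; try ring)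

lemma noisy_mul_noisy {ε : ℝ} (h0 : 0 ≤ ε) (h1 : ε ≤ 1) (a b : Fin n) (x u : Fin n → ℝ) :
    (√(1 - ε) * x a + √ε * u a) * (√(1 - ε) * x b + √ε * u b)
      = (1 - ε) * (x a * x b) + (√(1 - ε) * √ε * x a * u b
        + (√(1 - ε) * √ε * x b * u a + ε * (u a * u b))) := by
  have e1 : √(1 - ε) * √(1 - ε) = 1 - ε := Real.mul_self_sqrt (by linarith)
  have e2 : √ε * √ε = ε := Real.mul_self_sqrt h0
  linear_combination (x a * x b) * e1 + (u a * u b) * e2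

lemma integrable_noisy_mul_noisy {ε : ℝ} (h0 : 0 ≤ ε) (h1 : ε ≤ 1) (a b : Fin n)
    (x : Fin n → ℝ) :
    Integrable (fun u : Fin n → ℝ => (√(1 - ε) * x a + √ε * u a) * (√(1 - ε) * x b + √ε * u b))
      (Measure.pi fun _ => gaussianReal 0 1) := by
  simp only [noisy_mul_noisy h0 h1]
  exact (integrable_const _).add (((integrable_eval_gaussian b).const_mul _).add
    (((integrable_eval_gaussian a).const_mul _).add ((integrable_mul_gaussian a b).const_mul _)))

lemma integral_noisy_mul_noisy {ε : ℝ} (h0 : 0 ≤ ε) (h1 : ε ≤ 1) (a b : Fin n)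
    (x : Fin n → ℝ) :
    ∫ u : Fin n → ℝ, (√(1 - ε) * x a + √ε * u a) * (√(1 - ε) * x b + √ε * u b)
      ∂(Measure.pi fun _ => gaussianReal 0 1) = noisyPair ε a b x := by
  simp only [noisy_mul_noisy h0 h1]
  have i1 := (integrable_eval_gaussian b).const_mul (√(1 - ε) * √ε * x a)
  have i2 := (integrable_eval_gaussian a).const_mul (√(1 - ε) * √ε * x b)
  have i3 := (integrable_mul_gaussian a b).const_mul ε
  rw [integral_add (integrable_const _) (by fun_prop), integral_add i1 (by fun_prop),
    integral_add i2 i3, integral_const]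
  simp only [integral_const_mul, integral_mul_gaussian, integral_eval_gaussian, noisyPair]
  simp

instance : IsProbabilityMeasure (gMatR n) := by
  unfold gMatR
  infer_instance

lemma integrable_prod_rows {h : Fin n → (Fin n → ℝ) → ℝ}
    (hh : ∀ i, Integrable (h i) (Measure.pi fun _ => gaussianReal 0 1)) :
    Integrable (fun X => ∏ i, h i (X i)) (gMatR n) :=
  Integrable.fintype_prod hh

lemma integral_prod_rows (h : Fin n → (Fin n → ℝ) → ℝ) :
    ∫ X, ∏ i, h i (X i) ∂(gMatR n)
      = ∏ i, ∫ x, h i x ∂(Measure.pi fun _ => gaussianReal 0 1) :=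
  integral_fintype_prod_eq_prod h

lemma rperm_sq (A : Fin n → Fin n → ℝ) :
    rperm A ^ 2 = ∑ σ : Equiv.Perm (Fin n), ∑ τ : Equiv.Perm (Fin n),
      ∏ i, (A i (σ i) * A i (τ i)) := by
  simp only [rperm, sq, Finset.sum_mul_sum, Finset.prod_mul_distrib]

lemma gFunR_eq {ε : ℝ} (h0 : 0 ≤ ε) (h1 : ε ≤ 1) :
    gFunR n ε = fun X => ∑ σ : Equiv.Perm (Fin n), ∑ τ : Equiv.Perm (Fin n),
      ∏ i, noisyPair ε (σ i) (τ i) (X i) := by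
  funext X
  have hprod (σ τ : Equiv.Perm (Fin n)) : Integrable (fun U : Fin n → Fin n → ℝ =>
      ∏ i, (noisyR ε X U i (σ i) * noisyR ε X U i (τ i))) (gMatR n) :=
    integrable_prod_rows fun i => integrable_noisy_mul_noisy h0 h1 (σ i) (τ i) (X i)
  simp only [gFunR, rperm_sq]
  rw [integral_finsetSum _ fun σ _ => integrable_finsetSum _ fun τ _ => hprod σ τ]
  refine Finset.sum_congr rfl fun σ _ => ?_
  rw [integral_finsetSum _ fun τ _ => hprod σ τ]
  refine Finset.sum_congr rfl fun τ _ => ?_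
  refine (integral_prod_rows fun i u => (√(1 - ε) * X i (σ i) + √ε * u (σ i)) *
    (√(1 - ε) * X i (τ i) + √ε * u (τ i))).trans ?_
  exact Finset.prod_congr rfl fun i _ => integral_noisy_mul_noisy h0 h1 _ _ _

lemma rperm_sq_eq_gFunR_zero : (fun X : Fin n → Fin n → ℝ => rperm X ^ 2) = gFunR n 0 := by
  rw [gFunR_eq le_rfl zero_le_one]
  funext X
  simp [rperm_sq, noisyPair]

lemma integrable_gFunR {ε : ℝ} (h0 : 0 ≤ ε) (h1 : ε ≤ 1) :
    Integrable (gFunR n ε) (gMatR n) := by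
  rw [gFunR_eq h0 h1]
  exact integrable_finsetSum _ fun σ _ => integrable_finsetSum _ fun τ _ =>
    integrable_prod_rows fun i => integrable_noisyPair _ _ _

lemma integral_gFunR {ε : ℝ} (h0 : 0 ≤ ε) (h1 : ε ≤ 1) :
    ∫ X, gFunR n ε X ∂(gMatR n) = n.factorial := by
  have hprod (σ τ : Equiv.Perm (Fin n)) : Integrable (fun X : Fin n → Fin n → ℝ =>
      ∏ i, noisyPair ε (σ i) (τ i) (X i)) (gMatR n) :=
    integrable_prod_rows fun i => integrable_noisyPair _ _ _
  rw [gFunR_eq h0 h1, integral_finsetSum _ fun σ _ => integrable_finsetSum _ fun τ _ => hprod σ τ]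
  have h (σ : Equiv.Perm (Fin n)) : ∫ X, ∑ τ : Equiv.Perm (Fin n),
      ∏ i, noisyPair ε (σ i) (τ i) (X i) ∂(gMatR n) = 1 := by
    rw [integral_finsetSum _ fun τ _ => hprod σ τ]
    simp only [integral_prod_rows fun i => noisyPair ε (σ i) (_), integral_noisyPair,
      Finset.prod_ite_zero, Finset.prod_const_one, Finset.mem_univ, true_imp_iff,
      ← Equiv.ext_iff]
    simp
  simp [h, Fintype.card_perm]

lemma gFunR_mul_gFunR {ε δ : ℝ} (h0 : 0 ≤ ε) (h1 : ε ≤ 1) (k0 : 0 ≤ δ) (k1 : δ ≤ 1)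
    (X : Fin n → Fin n → ℝ) :
    gFunR n ε X * gFunR n δ X = ∑ σ₁ : Equiv.Perm (Fin n), ∑ σ₂ : Equiv.Perm (Fin n),
      ∑ σ₃ : Equiv.Perm (Fin n), ∑ σ₄ : Equiv.Perm (Fin n),
        ∏ i, (noisyPair ε (σ₁ i) (σ₂ i) (X i) * noisyPair δ (σ₃ i) (σ₄ i) (X i)) := by
  simp only [gFunR_eq h0 h1, gFunR_eq k0 k1, Finset.prod_mul_distrib, Finset.sum_mul]
  simp only [Finset.mul_sum]

lemma integrable_prod_noisyPair_mul (ε δ : ℝ) (σ₁ σ₂ σ₃ σ₄ : Equiv.Perm (Fin n)) :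
    Integrable (fun X : Fin n → Fin n → ℝ =>
      ∏ i, (noisyPair ε (σ₁ i) (σ₂ i) (X i) * noisyPair δ (σ₃ i) (σ₄ i) (X i))) (gMatR n) :=
  integrable_prod_rows fun i => integrable_noisyPair_mul ε δ (σ₁ i) (σ₂ i) (σ₃ i) (σ₄ i)

lemma integrable_gFunR_mul {ε δ : ℝ} (h0 : 0 ≤ ε) (h1 : ε ≤ 1) (k0 : 0 ≤ δ) (k1 : δ ≤ 1) :
    Integrable (fun X => gFunR n ε X * gFunR n δ X) (gMatR n) := by
  simp only [gFunR_mul_gFunR h0 h1 k0 k1]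
  exact integrable_finsetSum _ fun σ₁ _ => integrable_finsetSum _ fun σ₂ _ =>
    integrable_finsetSum _ fun σ₃ _ => integrable_finsetSum _ fun σ₄ _ =>
      integrable_prod_noisyPair_mul ε δ σ₁ σ₂ σ₃ σ₄

lemma integral_gFunR_mul {ε δ : ℝ} (h0 : 0 ≤ ε) (h1 : ε ≤ 1) (k0 : 0 ≤ δ) (k1 : δ ≤ 1) :
    ∫ X, gFunR n ε X * gFunR n δ X ∂(gMatR n)
      = (n.factorial : ℝ) ^ 2
        * ∑ k ∈ Finset.range (n + 1), ((k : ℝ) + 1) * ((1 - ε) * (1 - δ)) ^ k := by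
  have hprod := integrable_prod_noisyPair_mul (n := n) ε δ
  have hsum := sum_prod_wickWeight (α := Fin n) ((1 - ε) * (1 - δ))
  rw [Fintype.card_fin] at hsum
  simp only [gFunR_mul_gFunR h0 h1 k0 k1]
  rw [← hsum, integral_finsetSum _ fun σ₁ _ => integrable_finsetSum _ fun σ₂ _ =>
    integrable_finsetSum _ fun σ₃ _ => integrable_finsetSum _ fun σ₄ _ => hprod σ₁ σ₂ σ₃ σ₄]
  refine Finset.sum_congr rfl fun σ₁ _ => ?_
  rw [integral_finsetSum _ fun σ₂ _ => integrable_finsetSum _ fun σ₃ _ =>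
    integrable_finsetSum _ fun σ₄ _ => hprod σ₁ σ₂ σ₃ σ₄]
  refine Finset.sum_congr rfl fun σ₂ _ => ?_
  rw [integral_finsetSum _ fun σ₃ _ => integrable_finsetSum _ fun σ₄ _ => hprod σ₁ σ₂ σ₃ σ₄]
  refine Finset.sum_congr rfl fun σ₃ _ => ?_
  rw [integral_finsetSum _ fun σ₄ _ => hprod σ₁ σ₂ σ₃ σ₄]
  refine Finset.sum_congr rfl fun σ₄ _ => ?_
  rw [integral_prod_rows fun i x => noisyPair ε (σ₁ i) (σ₂ i) x * noisyPair δ (σ₃ i) (σ₄ i) x]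
  exact Finset.prod_congr rfl fun i _ => integral_noisyPair_mul _ _ _ _ _ _

/-- The covariance of two noisy squared permanents; the summands are the weights of the
successive even Hermite degrees. -/
lemma cov_gFunR {ε δ : ℝ} (h0 : 0 ≤ ε) (h1 : ε ≤ 1) (k0 : 0 ≤ δ) (k1 : δ ≤ 1) :
    cov (gMatR n) (gFunR n ε) (gFunR n δ)
      = (n.factorial : ℝ) ^ 2
        * ∑ k ∈ Finset.range n, ((k : ℝ) + 2) * ((1 - ε) * (1 - δ)) ^ (k + 1) := by
  have hexp (X : Fin n → Fin n → ℝ) :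
      (gFunR n ε X - n.factorial) * (gFunR n δ X - n.factorial)
        = gFunR n ε X * gFunR n δ X - n.factorial * gFunR n δ X
          - (n.factorial * gFunR n ε X - n.factorial * n.factorial) := by ring
  have i1 := integrable_gFunR_mul (n := n) h0 h1 k0 k1
  have i2 := (integrable_gFunR (n := n) h0 h1).const_mul (n.factorial : ℝ)
  have i3 := (integrable_gFunR (n := n) k0 k1).const_mul (n.factorial : ℝ)
  simp only [cov, integral_gFunR h0 h1, integral_gFunR k0 k1, hexp]
  rw [integral_sub (by fun_prop) (by fun_prop), integral_sub i1 i3,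
    integral_sub i2 (integrable_const _), integral_const_mul, integral_const_mul,
    integral_gFunR h0 h1, integral_gFunR k0 k1, integral_gFunR_mul h0 h1 k0 k1, integral_const,
    Finset.sum_range_succ']
  simp only [probReal_univ, one_smul, Nat.cast_add, Nat.cast_one, Nat.cast_zero, pow_zero,
    add_assoc, one_add_one_eq_two]
  ring

end Covariance

section Estimates

lemma sq_mul_sum_succ_mul_pow_le_one (n : ℕ) {t : ℝ} (h0 : 0 ≤ t) (h1 : t ≤ 1) :
    (1 - t) ^ 2 * ∑ k ∈ Finset.range n, ((k : ℝ) + 1) * t ^ k ≤ 1 := by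
  have h : (1 - t) ^ 2 * ∑ k ∈ Finset.range n, ((k : ℝ) + 1) * t ^ k
      = 1 - t ^ n - n * t ^ n * (1 - t) := by
    induction n with
    | zero => simp
    | succ n ih =>
      rw [Finset.sum_range_succ, mul_add, ih]
      push_cast
      ring
  rw [h]
  have : 0 ≤ n * t ^ n * (1 - t) := mul_nonneg (by positivity) (by linarith)
  have := pow_nonneg h0 n
  linarith

lemma sq_div_two_le_sum_succ (n : ℕ) :
    (n : ℝ) ^ 2 / 2 ≤ ∑ k ∈ Finset.range n, ((k : ℝ) + 1) := by
  induction n with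
  | zero => simp
  | succ n ih =>
    rw [Finset.sum_range_succ]
    push_cast
    nlinarith

lemma one_le_mul_sum_succ_mul_sq_pow (n : ℕ) {ε : ℝ} (h0 : 0 < ε) (h1 : ε < 1)
    (hn : 1 ≤ n * ε) :
    1 ≤ 32 * ε ^ 2 * ∑ k ∈ Finset.range n, ((k : ℝ) + 1) * ((1 - ε) ^ 2) ^ k := by
  set m := ⌊1 / (2 * ε)⌋₊
  have hm : (m : ℝ) ≤ 1 / (2 * ε) := Nat.floor_le (by positivity)
  have hm' : 1 / (2 * ε) < m + 1 := Nat.lt_floor_add_one _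
  rw [le_div_iff₀ (by positivity)] at hm
  rw [div_lt_iff₀ (by positivity)] at hm'
  have hmn : m + 1 ≤ n := by
    have : (m : ℝ) < n := by
      by_contra! hc
      nlinarith
    exact_mod_cast this
  have hsub : ∑ k ∈ Finset.range (m + 1), ((k : ℝ) + 1) * (1 / 4)
      ≤ ∑ k ∈ Finset.range n, ((k : ℝ) + 1) * ((1 - ε) ^ 2) ^ k := by
    refine (Finset.sum_le_sum fun k hk => ?_).trans
      (Finset.sum_le_sum_of_subset_of_nonneg (Finset.range_mono hmn) fun k _ _ => by positivity)
    have hk : (k : ℝ) ≤ m := by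
      exact_mod_cast Nat.lt_succ_iff.1 (Finset.mem_range.1 hk)
    have hB : 1 + (k : ℝ) * (-ε) ≤ (1 + -ε) ^ k := one_add_mul_le_pow (by linarith) k
    have hhalf : 1 / 2 ≤ (1 - ε) ^ k := by
      rw [← sub_eq_add_neg] at hB
      nlinarith
    have : 1 / 4 ≤ ((1 - ε) ^ 2) ^ k := by
      rw [← pow_mul, mul_comm, pow_mul]
      nlinarith
    gcongr
  rw [← Finset.sum_mul] at hsub
  have hS := sq_div_two_le_sum_succ (m + 1)
  push_cast at hS
  have hsum : ((m : ℝ) + 1) ^ 2 / 8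
      ≤ ∑ k ∈ Finset.range n, ((k : ℝ) + 1) * ((1 - ε) ^ 2) ^ k := by linarith
  have hε : 1 ≤ (2 * ε * (m + 1)) ^ 2 := by nlinarith
  calc 1 ≤ (2 * ε * (m + 1)) ^ 2 := hε
    _ = 32 * ε ^ 2 * (((m : ℝ) + 1) ^ 2 / 8) := by ring
    _ ≤ _ := by gcongr

lemma sum_add_two_mul_pow_div_le (n : ℕ) {ε : ℝ} (h0 : 0 < ε) (h1 : ε < 1) (hn : 1 ≤ n * ε) :
    (∑ k ∈ Finset.range n, ((k : ℝ) + 2) * (1 - ε) ^ (k + 1)) /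
      (√(∑ k ∈ Finset.range n, ((k : ℝ) + 2)) *
        √(∑ k ∈ Finset.range n, ((k : ℝ) + 2) * ((1 - ε) ^ 2) ^ (k + 1))) ≤ 16 / (n * ε) := by
  have ht : 0 < 1 - ε := by linarith
  have hnum : ∑ k ∈ Finset.range n, ((k : ℝ) + 2) * (1 - ε) ^ (k + 1)
      ≤ 2 * (1 - ε) / ε ^ 2 := by
    have h := sq_mul_sum_succ_mul_pow_le_one n ht.le (by linarith)
    rw [sub_sub_cancel] at h
    rw [le_div_iff₀ (by positivity)]
    calc _ ≤ (∑ k ∈ Finset.range n, 2 * (1 - ε) * (((k : ℝ) + 1) * (1 - ε) ^ k)) * ε ^ 2 := by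
          refine mul_le_mul_of_nonneg_right (Finset.sum_le_sum fun k _ => ?_) (by positivity)
          rw [pow_succ]
          have := mul_nonneg (k.cast_nonneg (α := ℝ)) (mul_nonneg (pow_nonneg ht.le k) ht.le)
          nlinarith
      _ = 2 * (1 - ε) * (ε ^ 2 * ∑ k ∈ Finset.range n, ((k : ℝ) + 1) * (1 - ε) ^ k) := by
          rw [← Finset.mul_sum]
          ring
      _ ≤ 2 * (1 - ε) * 1 := by gcongr
      _ = _ := mul_one _
  have hvar : (n : ℝ) ^ 2 / 2 ≤ ∑ k ∈ Finset.range n, ((k : ℝ) + 2) :=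
    (sq_div_two_le_sum_succ n).trans (Finset.sum_le_sum fun k _ => by linarith)
  have hnoisy : (1 - ε) ^ 2 / (32 * ε ^ 2)
      ≤ ∑ k ∈ Finset.range n, ((k : ℝ) + 2) * ((1 - ε) ^ 2) ^ (k + 1) := by
    have h := one_le_mul_sum_succ_mul_sq_pow n h0 h1 hn
    rw [div_le_iff₀ (by positivity)]
    calc (1 - ε) ^ 2 ≤ (1 - ε) ^ 2 *
          (32 * ε ^ 2 * ∑ k ∈ Finset.range n, ((k : ℝ) + 1) * ((1 - ε) ^ 2) ^ k) :=
          le_mul_of_one_le_right (by positivity) h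
      _ = (∑ k ∈ Finset.range n, ((k : ℝ) + 1) * ((1 - ε) ^ 2) ^ (k + 1)) * (32 * ε ^ 2) := by
          simp only [pow_succ _ (_ : ℕ), ← mul_assoc, ← Finset.sum_mul]
          ring
      _ ≤ _ := by
          gcongr
          norm_num
  have hn0 : (0 : ℝ) < n := by
    by_contra! hc
    nlinarith
  have hden : n * (1 - ε) / (8 * ε) ≤ √(∑ k ∈ Finset.range n, ((k : ℝ) + 2)) *
      √(∑ k ∈ Finset.range n, ((k : ℝ) + 2) * ((1 - ε) ^ 2) ^ (k + 1)) := by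
    rw [← Real.sqrt_mul (by positivity)]
    refine Real.le_sqrt_of_sq_le ?_
    calc (n * (1 - ε) / (8 * ε)) ^ 2 = n ^ 2 / 2 * ((1 - ε) ^ 2 / (32 * ε ^ 2)) := by
          field_simp
          norm_num
      _ ≤ _ := by gcongr
  calc _ ≤ (2 * (1 - ε) / ε ^ 2) / (n * (1 - ε) / (8 * ε)) := by
        gcongr
    _ = 16 / (n * ε) := by
        field_simp
        norm_num

lemma corr_rperm_sq_gFunR (n : ℕ) {ε : ℝ} (h0 : 0 < ε) (h1 : ε < 1) :
    corr (gMatR n) (fun X => rperm X ^ 2) (gFunR n ε)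
      = (∑ k ∈ Finset.range n, ((k : ℝ) + 2) * (1 - ε) ^ (k + 1)) /
        (√(∑ k ∈ Finset.range n, ((k : ℝ) + 2)) *
          √(∑ k ∈ Finset.range n, ((k : ℝ) + 2) * ((1 - ε) ^ 2) ^ (k + 1))) := by
  have hfac : (0 : ℝ) < n.factorial := by exact_mod_cast n.factorial_pos
  rw [corr, rperm_sq_eq_gFunR_zero, cov_gFunR le_rfl zero_le_one h0.le h1.le,
    cov_gFunR le_rfl zero_le_one le_rfl zero_le_one, cov_gFunR h0.le h1.le h0.le h1.le,
    Real.sqrt_mul (by positivity), Real.sqrt_mul (by positivity), Real.sqrt_sq hfac.le,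
    mul_mul_mul_comm (n.factorial : ℝ), ← sq (n.factorial : ℝ),
    mul_div_mul_left _ _ (by positivity)]
  simp only [sub_zero, one_mul, one_pow, mul_one, ← sq]

end Estimates

/-- if n·ε_n → ∞ then corr(f_n, g_n) → 0, where f_n(X) = perm(X)² and
g_n(X) = E[perm(Y)² | X] for an ε_n-noise Y of the n×n real Gaussian matrix X. -/
theorem corr_perm_noisy_perm_real_tendsto_zero (ε : ℕ → ℝ)
    (hε : ∀ n, 1 ≤ n → ε n ∈ Set.Ioo (0 : ℝ) 1)
    (h : Tendsto (fun n : ℕ => (n : ℝ) * ε n) atTop atTop) :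
    Tendsto
      (fun n : ℕ => corr (gMatR n) (fun X => (rperm X) ^ 2) (gFunR n (ε n)))
      atTop (nhds 0) := by
  refine squeeze_zero' (g := fun n : ℕ => 16 / ((n : ℝ) * ε n)) ?_ ?_
    (h.const_div_atTop 16)
  · filter_upwards [eventually_ge_atTop 1] with n hn
    obtain ⟨h0, h1⟩ := hε n hn
    rw [corr_rperm_sq_gFunR n h0 h1]
    have : 0 < 1 - ε n := by linarith
    positivity
  · filter_upwards [eventually_ge_atTop 1, h.eventually_ge_atTop 1] with n hn hlarge
    obtain ⟨h0, h1⟩ := hε n hn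
    rw [corr_rperm_sq_gFunR n h0 h1]
    exact sum_add_two_mul_pow_div_le n h0 h1 hlarge
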